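/- Let G = ℤ/nℤ, A ⊆ ℤ nonempty finite, t = n + D_A(G) − 1, and S = (x_1,...,x_t) a sequence in G with A_i = A x_i. Suppose 0 ∉ Σ_n((A_1,...,A_t)), the stabilizer of Σ_n((A_1,...,A_t)) is trivial, and every a ∈ G satisfies |{j : a ∈ A_j}| ≤ n. Then the number r of indices i with |A_i| = 1 satisfies r ≥ 2 D_A(G). -/

import Mathlib

section
open scoped Pointwise

/-- The Scherk theorem. -/
theorem wd_scherk {G : Type*} [AddCommGroup G] [DecidableEq G] (k : ℕ) :
    ∀ (A B : Finset G), B.card = k → (0:G) ∈ A → (0:G) ∈ B →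
    (∀ a ∈ A, ∀ b ∈ B, a + b = 0 → a = 0 ∧ b = 0) →
    A.card + B.card ≤ (A + B).card + 1 := by
  induction k using Nat.strong_induction_on with
  | _ k ih =>
  intro A B hk hA hB hu
  by_cases hex : ∃ e ∈ A, ∃ b ∈ B, b + e ∉ A
  · obtain ⟨e, he, b, hb, hbe⟩ := hex
    set A' := A ∪ B.image (fun b => b + e) with hA'
    set B' := B.filter (fun b => b + e ∈ A) with hB'
    have hlt : B'.card < B.card := by
      apply Finset.card_lt_card
      rw [Finset.ssubset_iff_of_subset (Finset.filter_subset _ _)]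
      exact ⟨b, hb, by simp [hB', hbe]⟩
    have hsub : A' + B' ⊆ A + B := by
      intro s hs
      obtain ⟨p, hp, r, hr, rfl⟩ := Finset.mem_add.1 hs
      rw [hB', Finset.mem_filter] at hr
      rw [hA', Finset.mem_union, Finset.mem_image] at hp
      rcases hp with hp | ⟨c, hc, rfl⟩
      · exact Finset.add_mem_add hp hr.1
      · have : c + e + r = (r + e) + c := by abel
        rw [this]
        exact Finset.add_mem_add hr.2 hc
    have hcard : A'.card + B'.card = A.card + B.card := by
      have h1 : (B.image (fun b => b + e)).card = B.card :=
        Finset.card_image_of_injective _ (add_left_injective e)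
      have h2 : (A ∩ B.image (fun b => b + e)).card = B'.card := by
        have : A ∩ B.image (fun b => b + e) = B'.image (fun b => b + e) := by
          ext s
          simp only [hB', Finset.mem_inter, Finset.mem_image, Finset.mem_filter]
          constructor
          · rintro ⟨h, c, hc, rfl⟩
            exact ⟨c, ⟨hc, h⟩, rfl⟩
          · rintro ⟨c, ⟨hc, h⟩, rfl⟩
            exact ⟨h, c, hc, rfl⟩
        rw [this, Finset.card_image_of_injective _ (add_left_injective e)]
      have := Finset.card_union_add_card_inter A (B.image (fun b => b + e))
      rw [h1, h2] at this
      exact this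
    have h0A : (0:G) ∈ A' := Finset.mem_union_left _ hA
    have h0B : (0:G) ∈ B' := by simp [hB', hB, he]
    have hu' : ∀ a ∈ A', ∀ b ∈ B', a + b = 0 → a = 0 ∧ b = 0 := by
      intro p hp r hr hpr
      rw [hB', Finset.mem_filter] at hr
      rw [hA', Finset.mem_union, Finset.mem_image] at hp
      rcases hp with hp | ⟨c, hc, rfl⟩
      · exact hu p hp r hr.1 hpr
      · have h1 : (r + e) + c = 0 := by rw [← hpr]; abel
        obtain ⟨h2, h3⟩ := hu _ hr.2 _ hc h1
        have h4 : e + r = 0 := by rw [add_comm]; exact h2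
        obtain ⟨h5, h6⟩ := hu e he r hr.1 h4
        simp [h3, h5, h6]
    have := ih B'.card (hk ▸ hlt) A' B' rfl h0A h0B hu'
    have h7 := Finset.card_le_card hsub
    omega
  · push Not at hex
    have hB0 : B = {0} := by
      refine Finset.eq_singleton_iff_unique_mem.2 ⟨hB, fun b hb => ?_⟩
      have himg : A.image (fun a => b + a) = A := by
        apply Finset.eq_of_subset_of_card_le
        · intro s hs
          obtain ⟨a, ha, rfl⟩ := Finset.mem_image.1 hs
          exact hex a ha b hb
        · rw [Finset.card_image_of_injective _ (add_right_injective b)]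
      have : (0:G) ∈ A.image (fun a => b + a) := by rw [himg]; exact hA
      obtain ⟨a, ha, hab⟩ := Finset.mem_image.1 this
      exact (hu a ha b hb (by rw [add_comm]; exact hab)).2
    rw [hB0]
    simp

/-- The Scherk theorem for several sets. -/
theorem wd_scherk_multi {G κ : Type*} [AddCommGroup G] [DecidableEq G] [DecidableEq κ]
    (C : κ → Finset G) (s : Finset κ) (h0 : ∀ i ∈ s, (0:G) ∈ C i)
    (hu : ∀ c : κ → G, (∀ i ∈ s, c i ∈ C i) → ∑ i ∈ s, c i = 0 → ∀ i ∈ s, c i = 0) :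
    ∃ P : Finset G, (∀ p, p ∈ P ↔ ∃ c : κ → G, (∀ i ∈ s, c i ∈ C i) ∧ ∑ i ∈ s, c i = p) ∧
      1 + ∑ i ∈ s, ((C i).card - 1) ≤ P.card := by
  induction s using Finset.induction_on with
  | empty => exact ⟨{0}, by simp [eq_comm], by simp⟩
  | insert k s hk ih =>
    obtain ⟨P, hP, hc⟩ := ih (fun i hi => h0 i (Finset.mem_insert_of_mem hi)) (by
      intro c hc hs i hi
      have h := hu (fun j => if j = k then 0 else c j) (by
        intro j hj
        by_cases hjk : j = k
        · subst hjk; simpa using h0 j hj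
        · simpa [hjk] using hc j (by simpa [hjk] using hj)) (by
        rw [Finset.sum_insert hk]
        simp only [if_true, zero_add]
        rw [← hs]
        apply Finset.sum_congr rfl
        intro j hj
        have : j ≠ k := fun h => hk (h ▸ hj)
        simp [this]) i (Finset.mem_insert_of_mem hi)
      have : i ≠ k := fun h => hk (h ▸ hi)
      simpa [this] using h)
    have key : ∀ (c : κ → G) (b : G), (∀ i ∈ s, c i ∈ C i) → b ∈ C k →
        (∀ i ∈ insert k s, (fun j => if j = k then b else c j) i ∈ C i) ∧
        ∑ i ∈ insert k s, (fun j => if j = k then b else c j) i = b + ∑ i ∈ s, c i := by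
      intro c b hc hb
      refine ⟨?_, ?_⟩
      · intro j hj
        by_cases hjk : j = k
        · subst hjk; simpa using hb
        · simpa [hjk] using hc j (by simpa [hjk] using hj)
      · rw [Finset.sum_insert hk]
        simp only [if_true]
        congr 1
        apply Finset.sum_congr rfl
        intro j hj
        have : j ≠ k := fun h => hk (h ▸ hj)
        simp [this]
    refine ⟨P + C k, ?_, ?_⟩
    · intro p
      rw [Finset.mem_add]
      constructor
      · rintro ⟨a, ha, b, hb, rfl⟩
        obtain ⟨c, hc, rfl⟩ := (hP a).1 ha
        exact ⟨_, (key c b hc hb).1, by rw [(key c b hc hb).2, add_comm]⟩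
      · rintro ⟨c, hc, rfl⟩
        refine ⟨∑ i ∈ s, c i, (hP _).2 ⟨c, fun i hi => hc i (Finset.mem_insert_of_mem hi), rfl⟩,
          c k, hc k (Finset.mem_insert_self _ _), ?_⟩
        rw [Finset.sum_insert hk, add_comm]
    · have h0P : (0:G) ∈ P := (hP 0).2 ⟨fun _ => 0, fun i hi => h0 i (Finset.mem_insert_of_mem hi), by simp⟩
      have h0k := h0 k (Finset.mem_insert_self _ _)
      have := wd_scherk (C k).card P (C k) rfl h0P h0k (by
        intro a ha b hb hab
        obtain ⟨c, hc, rfl⟩ := (hP a).1 ha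
        obtain ⟨k1, k2⟩ := key c b hc hb
        have h := hu _ k1 (by rw [k2, add_comm]; exact hab) k (Finset.mem_insert_self _ _)
        have hb0 : b = 0 := by simpa using h
        refine ⟨?_, hb0⟩
        rw [hb0, add_zero] at hab
        exact hab)
      rw [Finset.sum_insert hk]
      have hpos : 0 < (C k).card := Finset.card_pos.2 ⟨0, h0k⟩
      omega

/-- Any `|L|` terms of a sequence over a finite group `L` contain a short zero-sum. -/
theorem wd_short {Q ι : Type*} [AddCommGroup Q] [DecidableEq Q] [DecidableEq ι]
    (L : AddSubgroup Q) [Finite L] (f : ι → Q) (Y : Finset ι) (hf : ∀ j ∈ Y, f j ∈ L) (v : ℕ)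
    (hv : ∀ a, (Y.filter (fun j => f j = a)).card ≤ v) (hY : Nat.card L ≤ Y.card) :
    ∃ B ⊆ Y, B.Nonempty ∧ B.card ≤ v ∧ B.card ≤ Nat.card L ∧ ∑ j ∈ B, f j = 0 := by
  obtain ⟨Y', hY', hcard⟩ := Finset.exists_subset_card_eq hY
  suffices h : ∃ B ⊆ Y', B.Nonempty ∧ B.card ≤ v ∧ ∑ j ∈ B, f j = 0 by
    obtain ⟨B, h1, h2, h3, h4⟩ := h
    exact ⟨B, h1.trans hY', h2, h3, hcard ▸ Finset.card_le_card h1, h4⟩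
  have hv' : ∀ a, (Y'.filter (fun j => f j = a)).card ≤ v := fun a =>
    (Finset.card_le_card (Finset.filter_subset_filter _ hY')).trans (hv a)
  by_contra hcon
  push Not at hcon
  -- colouring
  have hcol : ∃ col : ι → Fin v, ∀ j ∈ Y', ∀ j' ∈ Y', f j = f j' → col j = col j' → j = j' := by
    have : ∀ a, ∃ g : ι → ℕ, (∀ j ∈ Y'.filter (fun j => f j = a), g j < v) ∧
        Set.InjOn g (Y'.filter (fun j => f j = a)) := by
      intro a
      let e := (Y'.filter (fun j => f j = a)).equivFin
      refine ⟨fun j => if h : j ∈ Y'.filter (fun j => f j = a) then (e ⟨j, h⟩ : ℕ) else 0, ?_, ?_⟩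
      · intro j hj
        simp only [hj, dif_pos]
        exact lt_of_lt_of_le (e ⟨j, hj⟩).2 (hv' a)
      · intro j hj j' hj' h
        have hj1 : j ∈ Y'.filter (fun j => f j = a) := hj
        have hj2 : j' ∈ Y'.filter (fun j => f j = a) := hj'
        simp only [hj1, hj2, dif_pos] at h
        have := e.injective (Fin.ext h)
        simpa using this
    choose g hg1 hg2 using this
    have hYne : Y'.Nonempty := by
      rw [← Finset.card_pos, hcard]; exact Nat.card_pos
    obtain ⟨j0, hj0⟩ := hYne
    have hvpos : 0 < v := by
      have := hg1 (f j0) j0 (by simp [hj0]); omega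
    refine ⟨fun j => ⟨g (f j) j % v, Nat.mod_lt _ hvpos⟩, ?_⟩
    intro j hj j' hj' hff hc
    have h1 := hg1 (f j) j (by simp [hj])
    have h2 := hg1 (f j) j' (by simp [hj', hff])
    have h3 : g (f j) j % v = g (f j') j' % v := by simpa using hc
    rw [← hff, Nat.mod_eq_of_lt h1, Nat.mod_eq_of_lt h2] at h3
    exact hg2 (f j) (by simp [hj]) (by simp [hj', hff]) h3
  obtain ⟨col, hcol⟩ := hcol
  have hf0 : ∀ j ∈ Y', f j ≠ 0 := by
    intro j hj h
    refine hcon {j} (by simpa using hj) (by simp) ?_ (by simpa using h)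
    have : 0 < v := lt_of_le_of_lt (Nat.zero_le _) (col j).2
    rw [Finset.card_singleton]; exact this
  let C : Fin v → Finset Q := fun i => insert 0 ((Y'.filter (fun j => col j = i)).image f)
  obtain ⟨P, hP, hPc⟩ := wd_scherk_multi C Finset.univ (by simp [C]) (by
    intro c hc hs
    by_contra hne
    push Not at hne
    obtain ⟨i0, -, hi0⟩ := hne
    have hch : ∀ i : Fin v, c i ≠ 0 → ∃ j ∈ Y', col j = i ∧ f j = c i := by
      intro i hi
      have := hc i (Finset.mem_univ _)
      simp only [C, Finset.mem_insert, hi, false_or, Finset.mem_image, Finset.mem_filter] at this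
      obtain ⟨j, ⟨h1, h2⟩, h3⟩ := this
      exact ⟨j, h1, h2, h3⟩
    have : Nonempty ι := ⟨(hch i0 hi0).choose⟩
    choose! φ hφ1 hφ2 hφ3 using hch
    let s := Finset.univ.filter (fun i : Fin v => c i ≠ 0)
    have hinj : Set.InjOn φ (↑s : Set (Fin v)) := by
      intro a ha b hb hab
      have ha' : c a ≠ 0 := by simpa [s] using ha
      have hb' : c b ≠ 0 := by simpa [s] using hb
      rw [← hφ2 a ha', ← hφ2 b hb', hab]
    refine hcon (s.image φ) ?_ ?_ ?_ ?_
    · intro j hj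
      obtain ⟨i, hi, rfl⟩ := Finset.mem_image.1 hj
      exact hφ1 i (by simpa [s] using hi)
    · exact ⟨φ i0, Finset.mem_image_of_mem _ (by simp [s, hi0])⟩
    · calc (s.image φ).card ≤ s.card := Finset.card_image_le
        _ ≤ (Finset.univ : Finset (Fin v)).card := Finset.card_le_univ _
        _ = v := by simp
    · rw [Finset.sum_image hinj, ← hs]
      rw [Finset.sum_filter_of_ne (p := fun i => c i ≠ 0) (f := c) (s := Finset.univ) (by simp) |>.symm]
      apply Finset.sum_congr rfl
      intro i hi
      exact hφ3 i (by simpa [s] using hi))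
  have hsum : ∑ i : Fin v, ((C i).card - 1) = Y'.card := by
    rw [Finset.card_eq_sum_card_fiberwise (f := col) (t := Finset.univ) (by simp)]
    apply Finset.sum_congr rfl
    intro i _
    simp only [C]
    rw [Finset.card_insert_of_notMem, Finset.card_image_of_injOn, Nat.add_sub_cancel]
    · intro a ha b hb hab
      simp only [Finset.coe_filter, Set.mem_ofPred_eq] at ha hb
      exact hcol a ha.1 b hb.1 hab (ha.2.trans hb.2.symm)
    · simp only [Finset.mem_image, Finset.mem_filter, not_exists, not_and, and_imp]
      intro j hj _ h
      exact hf0 j hj h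
  have hle : P.card ≤ Nat.card L := by
    have : (P : Set Q) ⊆ (L : Set Q) := by
      intro p hp
      obtain ⟨c, hc, rfl⟩ := (hP p).1 hp
      apply L.sum_mem
      intro i hi
      have := hc i hi
      simp only [C, Finset.mem_insert, Finset.mem_image, Finset.mem_filter] at this
      rcases this with h | ⟨j, ⟨h1, h2⟩, h3⟩
      · rw [h]; exact L.zero_mem
      · rw [← h3]; exact hf j (hY' h1)
    have h2 := Set.ncard_le_ncard this (Set.toFinite (L : Set Q))
    rwa [Set.ncard_coe_finset] at h2
  omega

/-- Greedy extraction of short zero-sum blocks. -/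
theorem wd_extract {Q ι : Type*} [AddCommGroup Q] [DecidableEq Q] [DecidableEq ι]
    (L : AddSubgroup Q) [Finite L] (f : ι → Q) (v : ℕ) (k : ℕ) :
    ∀ W : Finset ι, W.card = k → (∀ j ∈ W, f j ∈ L) →
    (∀ a, (W.filter (fun j => f j = a)).card ≤ v) →
    ∃ (Y : Finset ι) (𝓑 : Finset (Finset ι)), Y ⊆ W ∧ Y.card < Nat.card L ∧
      (∀ B ∈ 𝓑, ∀ B' ∈ 𝓑, B ≠ B' → Disjoint B B') ∧ 𝓑.biUnion id = W \ Y ∧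
      ∀ B ∈ 𝓑, B.card ≤ v ∧ B.card ≤ Nat.card L ∧ ∑ j ∈ B, f j = 0 := by
  induction k using Nat.strong_induction_on with
  | _ k ih =>
  intro W hk hf hv
  by_cases hW : W.card < Nat.card L
  · exact ⟨W, ∅, subset_rfl, hW, by simp, by simp, by simp⟩
  · obtain ⟨B, hBW, hBne, hBv, hBq, hB0⟩ := wd_short L f W hf v hv (not_lt.1 hW)
    have hlt : (W \ B).card < W.card := by
      apply Finset.card_lt_card
      exact Finset.sdiff_ssubset hBW hBne
    obtain ⟨Y, 𝓑, h1, h2, h3, h4, h5⟩ := ih _ (hk ▸ hlt) (W \ B) rfl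
      (fun j hj => hf j (Finset.sdiff_subset hj))
      (fun a => (Finset.card_le_card (Finset.filter_subset_filter _ Finset.sdiff_subset)).trans (hv a))
    have hdis : ∀ B' ∈ 𝓑, Disjoint B B' := by
      intro B' hB'
      have : B' ⊆ 𝓑.biUnion id := Finset.subset_biUnion_of_mem id hB'
      rw [h4] at this
      rw [Finset.disjoint_left]
      intro j hj hj'
      have := this hj'
      simp [hj] at this
    refine ⟨Y, insert B 𝓑, h1.trans Finset.sdiff_subset, h2, ?_, ?_, ?_⟩
    · intro B1 hB1 B2 hB2 hne
      rcases Finset.mem_insert.1 hB1 with e1 | hB1' <;> rcases Finset.mem_insert.1 hB2 with e2 | hB2'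
      · exact absurd (e1.trans e2.symm) hne
      · rw [e1]; exact hdis _ hB2'
      · rw [e2]; exact (hdis _ hB1').symm
      · exact h3 _ hB1' _ hB2' hne
    · rw [Finset.biUnion_insert, h4]
      ext j
      simp only [id, Finset.mem_union, Finset.mem_sdiff]
      constructor
      · rintro (h | h)
        · refine ⟨hBW h, fun hY => ?_⟩
          have := h1 hY
          simp [h] at this
        · exact ⟨h.1.1, h.2⟩
      · rintro ⟨ha, hb⟩
        by_cases hj : j ∈ B
        · exact Or.inl hj
        · exact Or.inr ⟨⟨ha, hj⟩, hb⟩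
    · intro B' hB'
      rcases Finset.mem_insert.1 hB' with rfl | hB'
      · exact ⟨hBv, hBq, hB0⟩
      · exact h5 _ hB'

/-- Choosing blocks so that the total size lands in a window. -/
theorem wd_select {β : Type*} [DecidableEq β] (sz : β → ℕ) (M Bs : Finset β) (hM : M ⊆ Bs)
    (m n w : ℕ) (h1 : m + ∑ B ∈ M, sz B ≤ n) (h2 : n ≤ m + ∑ B ∈ Bs, sz B + w)
    (h3 : ∀ B ∈ Bs, sz B ≤ w + 1) :
    ∃ C, M ⊆ C ∧ C ⊆ Bs ∧ m + ∑ B ∈ C, sz B ≤ n ∧ n ≤ m + ∑ B ∈ C, sz B + w := by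
  let F := Bs.powerset.filter (fun C => M ⊆ C ∧ m + ∑ B ∈ C, sz B ≤ n)
  obtain ⟨C, hC, hmax⟩ := F.exists_max_image Finset.card ⟨M, by simp [F, hM, h1]⟩
  simp only [F, Finset.mem_filter, Finset.mem_powerset] at hC hmax
  obtain ⟨hCB, hMC, hCn⟩ := hC
  refine ⟨C, hMC, hCB, hCn, ?_⟩
  by_cases hEq : C = Bs
  · rw [hEq]; exact h2
  · obtain ⟨B, hB, hBC⟩ := Finset.exists_of_ssubset (hCB.ssubset_of_ne hEq)
    by_contra hlt
    have h4 := h3 B hB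
    have := hmax (insert B C) ⟨Finset.insert_subset hB hCB, hMC.trans (Finset.subset_insert _ _), by
      rw [Finset.sum_insert hBC]; omega⟩
    rw [Finset.card_insert_of_notMem hBC] at this
    omega

/-- Maximal weighted zero-sum part. -/
theorem wd_maxzero {G ι : Type*} [AddCommGroup G] [DecidableEq ι] (A : Finset ℤ)
    (D : ℕ) (a0 : ℤ) (ha0 : a0 ∈ A)
    (hD : ∀ y : Fin D → G, ∃ (s : Finset (Fin D)) (w : Fin D → ℤ),
      s.Nonempty ∧ (∀ i ∈ s, w i ∈ A) ∧ ∑ i ∈ s, w i • y i = 0)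
    (y : ι → G) (W : Finset ι) :
    ∃ F ⊆ W, ∃ w : ι → ℤ, (∀ i, w i ∈ A) ∧ ∑ i ∈ F, w i • y i = 0 ∧ (W \ F).card < D := by
  classical
  let Fs := W.powerset.filter (fun F => ∃ w : ι → ℤ, (∀ i, w i ∈ A) ∧ ∑ i ∈ F, w i • y i = 0)
  obtain ⟨F, hF, hmax⟩ := Fs.exists_max_image Finset.card
    ⟨∅, by simp only [Fs, Finset.mem_filter, Finset.mem_powerset]; exact ⟨by simp, fun _ => a0, by simp [ha0], by simp⟩⟩
  simp only [Fs, Finset.mem_filter, Finset.mem_powerset] at hF hmax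
  obtain ⟨hFW, w, hw, hs⟩ := hF
  refine ⟨F, hFW, w, hw, hs, ?_⟩
  by_contra hcon
  obtain ⟨W', hW', hc⟩ := Finset.exists_subset_card_eq (not_lt.1 hcon)
  let e := (W'.equivFinOfCardEq hc).symm
  obtain ⟨s, w', hsne, hw', hs'⟩ := hD (fun i => y (e i))
  let em : Fin D ↪ ι := ⟨fun i => (e i : ι), fun i j h => e.injective (Subtype.ext h)⟩
  have hem : ∀ i, em i ∈ W' := fun i => (e i).2
  let B := s.map em
  have hBW : B ⊆ W' := by
    intro j hj
    obtain ⟨i, _, rfl⟩ := Finset.mem_map.1 hj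
    exact hem i
  have hdis : Disjoint F B := by
    rw [Finset.disjoint_right]
    intro j hj
    have := hW' (hBW hj)
    exact (Finset.mem_sdiff.1 this).2
  let w2 : ι → ℤ := fun j => if h : ∃ i ∈ s, em i = j then w' h.choose else w j
  have hw2em : ∀ i ∈ s, w2 (em i) = w' i := by
    intro i hi
    have h : ∃ i' ∈ s, em i' = em i := ⟨i, hi, rfl⟩
    simp only [w2, dif_pos h]
    rw [em.injective h.choose_spec.2]
  have hw2F : ∀ j ∈ F, w2 j = w j := by
    intro j hj
    have h : ¬ ∃ i ∈ s, em i = j := by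
      rintro ⟨i, hi, rfl⟩
      exact (Finset.disjoint_left.1 hdis hj) (Finset.mem_map_of_mem _ hi)
    simp only [w2, dif_neg h]
  have := hmax (F ∪ B) ⟨Finset.union_subset hFW (hBW.trans (hW'.trans Finset.sdiff_subset)), w2, by
    intro j
    by_cases h : ∃ i ∈ s, em i = j
    · obtain ⟨i, hi, rfl⟩ := h
      rw [hw2em i hi]; exact hw' i hi
    · simp only [w2, dif_neg h]; exact hw j, by
    rw [Finset.sum_union hdis, Finset.sum_map]
    rw [Finset.sum_congr rfl (fun j hj => by rw [hw2F j hj]), hs, zero_add, ← hs']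
    apply Finset.sum_congr rfl
    intro i hi
    rw [hw2em i hi]
    rfl⟩
  rw [Finset.card_union_of_disjoint hdis] at this
  have h2 : 0 < B.card := by rw [Finset.card_map]; exact Finset.card_pos.2 hsne
  omega
end

section

/-- `B j` lies in a single coset of `H`. -/
def WdSing {G ι : Type*} [AddCommGroup G] (B : ι → Finset G) (H : AddSubgroup G) (j : ι) : Prop :=
  ∀ a ∈ B j, ∀ b ∈ B j, a - b ∈ H

/-- `I` fills `H2` modulo `H1`. -/
def WdRF {G ι : Type*} [AddCommGroup G] (B : ι → Finset G) (H1 H2 : AddSubgroup G)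
    (X I : Finset ι) : Prop :=
  I ⊆ X ∧ (∀ j ∈ I, WdSing B H2 j ∧ ¬ WdSing B H1 j) ∧
  (I.card + 1) * Nat.card H1 ≤ Nat.card H2 ∧
  ∀ c : ι → G, (∀ j ∈ I, c j ∈ B j) → ∀ k ∈ H2, ∃ c' : ι → G, (∀ j ∈ I, c' j ∈ B j) ∧
    ∑ j ∈ I, c' j - (∑ j ∈ I, c j + k) ∈ H1

theorem wd_sing_mono {G ι : Type*} [AddCommGroup G] {B : ι → Finset G} {H H' : AddSubgroup G}
    (h : H ≤ H') {j : ι} (hj : WdSing B H j) : WdSing B H' j :=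
  fun a ha b hb => h (hj a ha b hb)

theorem wd_rf_self {G ι : Type*} [AddCommGroup G] (B : ι → Finset G) (H : AddSubgroup G)
    (X : Finset ι) : WdRF B H H X ∅ := by
  refine ⟨by simp, by simp, by simp, ?_⟩
  intro c _ k hk
  exact ⟨c, by simp, by simpa using hk⟩

theorem wd_rf_comp {G ι : Type*} [AddCommGroup G] [DecidableEq ι] {B : ι → Finset G}
    {H1 H2 H3 : AddSubgroup G} (h12 : H1 ≤ H2) (h23 : H2 ≤ H3) {X I I' : Finset ι}
    (r1 : WdRF B H1 H2 X I) (r2 : WdRF B H2 H3 X I') : WdRF B H1 H3 X (I ∪ I') := by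
  obtain ⟨a1, a2, a3, a4⟩ := r1
  obtain ⟨b1, b2, b3, b4⟩ := r2
  have hdis : Disjoint I I' := by
    rw [Finset.disjoint_left]
    intro j hj hj'
    exact (b2 j hj').2 (a2 j hj).1
  refine ⟨Finset.union_subset a1 b1, ?_, ?_, ?_⟩
  · intro j hj
    rcases Finset.mem_union.1 hj with h | h
    · exact ⟨wd_sing_mono h23 (a2 j h).1, (a2 j h).2⟩
    · exact ⟨(b2 j h).1, fun hs => (b2 j h).2 (wd_sing_mono h12 hs)⟩
  · rw [Finset.card_union_of_disjoint hdis]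
    nlinarith [Nat.zero_le (I.card * Nat.card H1), Nat.zero_le (Nat.card H1),
      Nat.mul_le_mul_left I'.card (show Nat.card H1 ≤ Nat.card H2 by nlinarith [Nat.zero_le (I.card * Nat.card H1)])]
  · intro c hc k hk
    obtain ⟨c', hc', he⟩ := b4 c (fun j hj => hc j (Finset.mem_union_right _ hj)) k hk
    obtain ⟨c'', hc'', he'⟩ := a4 c (fun j hj => hc j (Finset.mem_union_left _ hj)) _ (H2.neg_mem he)
    refine ⟨fun j => if j ∈ I then c'' j else c' j, ?_, ?_⟩
    · intro j hj
      by_cases h : j ∈ I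
      · simpa [h] using hc'' j h
      · simpa [h] using hc' j (by simpa [h] using hj)
    · rw [Finset.sum_union hdis, Finset.sum_union hdis]
      have e1 : ∑ j ∈ I, (if j ∈ I then c'' j else c' j) = ∑ j ∈ I, c'' j :=
        Finset.sum_congr rfl (fun j hj => by simp [hj])
      have e2 : ∑ j ∈ I', (if j ∈ I then c'' j else c' j) = ∑ j ∈ I', c' j :=
        Finset.sum_congr rfl (fun j hj => by simp [Finset.disjoint_right.1 hdis hj])
      rw [e1, e2]
      convert he' using 1
      abel

theorem wd_dvd {G : Type*} [AddCommGroup G] [Finite G] (K : AddSubgroup G) (S : Finset G)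
    (hS : ∀ g ∈ S, ∀ k ∈ K, g + k ∈ S) : Nat.card K ∣ S.card := by
  classical
  cases nonempty_fintype G
  rw [Finset.card_eq_sum_card_image (QuotientAddGroup.mk : G → G ⧸ K) S]
  apply Finset.dvd_sum
  intro q hq
  obtain ⟨g, hg, rfl⟩ := Finset.mem_image.1 hq
  have : S.filter (fun a => (QuotientAddGroup.mk a : G ⧸ K) = QuotientAddGroup.mk g)
      = (Finset.univ.filter (fun k => k ∈ K)).image (fun k => g + k) := by
    ext a
    simp only [Finset.mem_filter, Finset.mem_image, Finset.mem_univ, true_and]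
    constructor
    · rintro ⟨_, h⟩
      exact ⟨-g + a, QuotientAddGroup.eq.1 h.symm, by abel⟩
    · rintro ⟨k, hk, rfl⟩
      exact ⟨hS g hg k hk, (QuotientAddGroup.eq.2 (by simpa using hk)).symm⟩
  rw [this, Finset.card_image_of_injective _ (add_right_injective g)]
  rw [Nat.card_eq_fintype_card, Fintype.card_subtype]

theorem wd_card_filter {G : Type*} [AddCommGroup G] [Fintype G] [DecidableEq G]
    (H : AddSubgroup G) [DecidablePred (· ∈ H)] :
    (Finset.univ.filter (fun k => k ∈ H)).card = Nat.card H := by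
  rw [Nat.card_eq_fintype_card, Fintype.card_subtype]

theorem wd_greedy {G ι : Type*} [AddCommGroup G] [Finite G] [DecidableEq ι] (B : ι → Finset G)
    (hB : ∀ j, (B j).Nonempty) (H1 : AddSubgroup G) (m : ℕ) :
    ∀ (H : AddSubgroup G) (X : Finset ι), Nat.card H = m → H1 < H →
    (∀ j ∈ X, WdSing B H j ∧ ¬ WdSing B H1 j) →
    Nat.card H ≤ Nat.card H1 * (X.card + 1) →
    ∃ H2 I, H1 < H2 ∧ H2 ≤ H ∧ WdRF B H1 H2 X I := by
  classical
  cases nonempty_fintype G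
  induction m using Nat.strong_induction_on with
  | _ m ih =>
  intro H X hm hlt hX hcard
  let S : Finset ι → Finset G := fun I => Finset.univ.filter (fun g => ∃ c : ι → G,
    (∀ j ∈ I, c j ∈ B j) ∧ g - ∑ j ∈ I, c j ∈ H1)
  have hSmem : ∀ I g, g ∈ S I ↔ ∃ c : ι → G, (∀ j ∈ I, c j ∈ B j) ∧ g - ∑ j ∈ I, c j ∈ H1 := by
    intro I g; simp [S]
  have hS1 : ∀ I, ∀ g ∈ S I, ∀ k ∈ H1, g + k ∈ S I := by
    intro I g hg k hk
    obtain ⟨c, hc, h⟩ := (hSmem _ _).1 hg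
    refine (hSmem _ _).2 ⟨c, hc, ?_⟩
    have : g + k - ∑ j ∈ I, c j = (g - ∑ j ∈ I, c j) + k := by abel
    rw [this]; exact H1.add_mem h hk
  have hSne : ∀ I, (S I).Nonempty := by
    intro I
    choose c hc using hB
    exact ⟨∑ j ∈ I, c j, (hSmem _ _).2 ⟨c, fun j _ => hc j, by simpa using H1.zero_mem⟩⟩
  have hScos : ∀ I ⊆ X, ∀ g ∈ S I, ∀ g' ∈ S I, g - g' ∈ H := by
    intro I hI g hg g' hg'
    obtain ⟨c, hc, h⟩ := (hSmem _ _).1 hg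
    obtain ⟨c', hc', h'⟩ := (hSmem _ _).1 hg'
    have h2 : ∑ j ∈ I, (c j - c' j) ∈ H :=
      H.sum_mem (fun j hj => (hX j (hI hj)).1 _ (hc j hj) _ (hc' j hj))
    have : g - g' = (g - ∑ j ∈ I, c j) - (g' - ∑ j ∈ I, c' j) + ∑ j ∈ I, (c j - c' j) := by
      rw [Finset.sum_sub_distrib]; abel
    rw [this]
    exact H.add_mem (H.sub_mem (hlt.le h) (hlt.le h')) h2
  have h1pos : 0 < Nat.card H1 := Nat.card_pos
  have hdvd1 : ∀ I, Nat.card H1 ∣ (S I).card := fun I => wd_dvd H1 _ (hS1 I)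
  let Fs := X.powerset.filter (fun I => (I.card + 1) * Nat.card H1 ≤ (S I).card)
  obtain ⟨I, hI, hmax⟩ := Fs.exists_max_image Finset.card ⟨∅, by
    simp only [Fs, Finset.mem_filter, Finset.mem_powerset, Finset.card_empty, zero_add, one_mul]
    exact ⟨by simp, Nat.le_of_dvd (Finset.card_pos.2 (hSne _)) (hdvd1 _)⟩⟩
  simp only [Fs, Finset.mem_filter, Finset.mem_powerset] at hI hmax
  obtain ⟨hIX, hIc⟩ := hI
  let H' : AddSubgroup G :=
    { carrier := {k | ∀ g, g ∈ S I ↔ g + k ∈ S I}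
      zero_mem' := by intro g; simp
      add_mem' := by
        intro a b ha hb g
        rw [ha g, hb (g + a), add_assoc]
      neg_mem' := by
        intro a ha g
        rw [ha (g + -a), neg_add_cancel_right] }
  have hH' : ∀ k, k ∈ H' ↔ ∀ g, g ∈ S I ↔ g + k ∈ S I := fun k => Iff.rfl
  have h1' : H1 ≤ H' := by
    intro k hk g
    refine ⟨fun h => hS1 I g h k hk, fun h => ?_⟩
    have := hS1 I _ h _ (H1.neg_mem hk)
    rwa [add_neg_cancel_right] at this
  obtain ⟨g0, hg0⟩ := hSne I
  have h'H : H' ≤ H := by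
    intro k hk
    have := hScos I hIX _ (((hH' k).1 hk g0).1 hg0) g0 hg0
    rwa [add_sub_cancel_left] at this
  have hSH : S I ⊆ (Finset.univ.filter (fun k => k ∈ H)).image (fun k => g0 + k) := by
    intro g hg
    exact Finset.mem_image.2 ⟨g - g0, by simpa using hScos I hIX g hg g0 hg0, by abel⟩
  have hcH : ((Finset.univ.filter (fun k => k ∈ H)).image (fun k => g0 + k)).card = Nat.card H := by
    rw [Finset.card_image_of_injective _ (add_right_injective g0), wd_card_filter]
  have hSle : (S I).card ≤ Nat.card H := hcH ▸ Finset.card_le_card hSH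
  by_cases hEq : H' = H
  · refine ⟨H, I, hlt, le_rfl, hIX, fun j hj => hX j (hIX hj), hIc.trans hSle, ?_⟩
    intro c hc k hk
    rw [← hEq] at hk
    have hs : ∑ j ∈ I, c j ∈ S I := (hSmem _ _).2 ⟨c, hc, by simpa using H1.zero_mem⟩
    obtain ⟨c', hc', h⟩ := (hSmem _ _).1 (((hH' k).1 hk _).1 hs)
    refine ⟨c', hc', ?_⟩
    rw [← neg_sub]
    exact H1.neg_mem h
  · have hSlt : (S I).card < Nat.card H := by
      refine lt_of_le_of_ne hSle (fun he => hEq (le_antisymm h'H ?_))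
      have hSeq := Finset.eq_of_subset_of_card_le hSH (by rw [hcH, he])
      intro k hk g
      rw [hSeq]
      simp only [Finset.mem_image, Finset.mem_filter, Finset.mem_univ, true_and]
      constructor
      · rintro ⟨a, ha, rfl⟩
        exact ⟨a + k, H.add_mem ha hk, by abel⟩
      · rintro ⟨a, ha, h⟩
        exact ⟨a - k, H.sub_mem ha hk, by rw [← add_sub_assoc, h]; abel⟩
    have hd2 : Nat.card H' ∣ (S I).card := wd_dvd H' _ (fun g hg k hk => ((hH' k).1 hk g).1 hg)
    have hd3 : Nat.card H' ∣ Nat.card H := AddSubgroup.card_dvd_of_le h'H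
    have hle : (S I).card + Nat.card H' ≤ Nat.card H := by
      obtain ⟨p, hp⟩ := hd2
      obtain ⟨r, hr⟩ := hd3
      rw [hp, hr] at hSlt ⊢
      have : p < r := lt_of_mul_lt_mul_left hSlt (Nat.zero_le _)
      nlinarith
    have hcc := Finset.card_sdiff_add_card_eq_card hIX
    have hsing : ∀ j ∈ X \ I, WdSing B H' j := by
      intro j hj
      rw [Finset.mem_sdiff] at hj
      by_contra hns
      simp only [WdSing] at hns
      push Not at hns
      obtain ⟨a, ha, b, hb, hab⟩ := hns
      have hin : ∀ z ∈ B j, (S I).image (fun g => g + z) ⊆ S (insert j I) := by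
        intro z hz g hg
        obtain ⟨g', hg', rfl⟩ := Finset.mem_image.1 hg
        obtain ⟨c, hc, h⟩ := (hSmem _ _).1 hg'
        refine (hSmem _ _).2 ⟨fun i => if i = j then z else c i, ?_, ?_⟩
        · intro i hi
          by_cases hij : i = j
          · subst hij; simpa using hz
          · simpa [hij] using hc i (by simpa [hij] using hi)
        · rw [Finset.sum_insert hj.2]
          have : ∑ i ∈ I, (if i = j then z else c i) = ∑ i ∈ I, c i := by
            apply Finset.sum_congr rfl
            intro i hi
            have : i ≠ j := fun h => hj.2 (h ▸ hi)
            simp [this]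
          rw [this]
          convert h using 1
          simp only [if_true]
          abel
      have hci : ∀ z : G, ((S I).image (fun g => g + z)).card = (S I).card := fun z =>
        Finset.card_image_of_injective _ (add_left_injective z)
      have hlt2 : (S I).card < (S (insert j I)).card := by
        by_contra hge
        have ea := Finset.eq_of_subset_of_card_le (hin a ha) (by rw [hci]; omega)
        have eb := Finset.eq_of_subset_of_card_le (hin b hb) (by rw [hci]; omega)
        apply hab
        intro g
        have e : g + a ∈ (S I).image (fun g => g + a) ↔ g + a ∈ (S I).image (fun g => g + b) := by
          rw [ea, eb]
        simp only [Finset.mem_image] at e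
        constructor
        · intro hg
          obtain ⟨g', hg', h⟩ := e.1 ⟨g, hg, rfl⟩
          have : g + (a - b) = g' := by rw [← add_sub_assoc, ← h]; abel
          rw [this]; exact hg'
        · intro hg
          obtain ⟨g', hg', h⟩ := e.2 ⟨_, hg, by abel⟩
          rw [← add_right_cancel h]; exact hg'
      have hge2 : (S I).card + Nat.card H1 ≤ (S (insert j I)).card := by
        obtain ⟨p, hp⟩ := hdvd1 I
        obtain ⟨r, hr⟩ := hdvd1 (insert j I)
        rw [hp, hr] at hlt2 ⊢
        have : p < r := lt_of_mul_lt_mul_left hlt2 (Nat.zero_le _)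
        nlinarith
      have := hmax (insert j I) ⟨Finset.insert_subset hj.1 hIX, by
        rw [Finset.card_insert_of_notMem hj.2]
        have : (I.card + 1 + 1) * Nat.card H1 = (I.card + 1) * Nat.card H1 + Nat.card H1 := by ring
        omega⟩
      rw [Finset.card_insert_of_notMem hj.2] at this
      omega
    have h'pos : 0 < Nat.card H' := Nat.card_pos
    have hlt' : Nat.card H' < m := by
      have := Finset.card_pos.2 (hSne I)
      omega
    have hkey : Nat.card H' ≤ Nat.card H1 * (X \ I).card := by
      have e : Nat.card H1 * (X.card + 1) = Nat.card H1 * (X \ I).card + (I.card + 1) * Nat.card H1 := by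
        rw [← hcc]; ring
      omega
    have hne : (X \ I).Nonempty := by
      rw [Finset.nonempty_iff_ne_empty]
      intro h
      rw [h, Finset.card_empty, mul_zero] at hkey
      omega
    obtain ⟨j, hj⟩ := hne
    have hneq : H1 ≠ H' := by
      intro h
      apply (hX j (Finset.sdiff_subset hj)).2
      rw [h]; exact hsing j hj
    obtain ⟨H2, I', a1, a2, a3, a4⟩ := ih (Nat.card H') hlt' H' (X \ I) rfl
      (lt_of_le_of_ne h1' hneq) (fun j hj => ⟨hsing j hj, (hX j (Finset.sdiff_subset hj)).2⟩)
      (by rw [mul_add]; omega)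
    exact ⟨H2, I', a1, a2.trans h'H, a3.trans Finset.sdiff_subset, a4⟩

theorem wd_maxfill {G ι : Type*} [AddCommGroup G] [Finite G] [DecidableEq ι] (B : ι → Finset G)
    (hB : ∀ j, (B j).Nonempty) (H0 H : AddSubgroup G) (hle : H0 ≤ H) (X : Finset ι)
    (hX : ∀ j ∈ X, WdSing B H j) :
    ∃ H1 I, H0 ≤ H1 ∧ H1 ≤ H ∧ WdRF B H0 H1 X I ∧
      (H1 = H ∨ ∀ X' : Finset ι, X' ⊆ X → (∀ j ∈ X', ¬ WdSing B H1 j) →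
        Nat.card H1 * (X'.card + 1) < Nat.card H) := by
  classical
  cases nonempty_fintype (AddSubgroup G)
  let Fs : Finset (AddSubgroup G) := Finset.univ.filter (fun K => H0 ≤ K ∧ K ≤ H ∧ ∃ I, WdRF B H0 K X I)
  obtain ⟨H1, h1, hmax⟩ := Fs.exists_max_image (fun K => Nat.card K) ⟨H0, by
    simp only [Fs, Finset.mem_filter, Finset.mem_univ, true_and]
    exact ⟨le_rfl, hle, ∅, wd_rf_self B H0 X⟩⟩
  simp only [Fs, Finset.mem_filter, Finset.mem_univ, true_and] at h1 hmax
  obtain ⟨h01, h1H, I, hI⟩ := h1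
  refine ⟨H1, I, h01, h1H, hI, ?_⟩
  by_cases hEq : H1 = H
  · exact Or.inl hEq
  right
  intro X' hX' hns
  by_contra hcon
  obtain ⟨H2, I', a1, a2, a3⟩ := wd_greedy B hB H1 (Nat.card H) H X' rfl (lt_of_le_of_ne h1H hEq)
    (fun j hj => ⟨hX j (hX' hj), hns j hj⟩) (not_lt.1 hcon)
  have r2 : WdRF B H1 H2 X I' := ⟨a3.1.trans hX', a3.2⟩
  have := hmax H2 ⟨h01.trans a1.le, a2, _, wd_rf_comp h01 a1.le hI r2⟩
  have h3 := AddSubgroup.eq_of_le_of_card_ge a1.le this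
  exact a1.ne h3
end

section

theorem wd_fill {G ι : Type*} [AddCommGroup G] [Finite G] [DecidableEq ι] (B : ι → Finset G)
    (hB : ∀ j, (B j).Nonempty) (H : AddSubgroup G) (N V Y : Finset ι) (d q : ℕ)
    (hq : 1 ≤ q) (hqd : q ≤ d)
    (hN : ∀ j ∈ N, WdSing B H j)
    (hcount : ∀ H' < H, ∃ X' ⊆ N \ Y, (∀ j ∈ X', ¬ WdSing B H' j) ∧
      d * Nat.card H + 2 ≤ X'.card + q + d * Nat.card H') :
    ∃ I, WdRF B ⊥ H (N \ Y) I ∧ ((V ∩ I).card ≤ 1 ∨ q ≤ (V \ I).card + 1) := by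
  classical
  obtain ⟨H1, I1, a1, a2, a3, a4⟩ := wd_maxfill B hB ⊥ H bot_le ((N \ Y) \ V)
    (fun j hj => hN j (Finset.sdiff_subset (Finset.sdiff_subset hj)))
  obtain ⟨H2, I2, b1, b2, b3, b4⟩ := wd_maxfill B hB H1 H a2 (N \ Y)
    (fun j hj => hN j (Finset.sdiff_subset hj))
  have hH2 : H2 = H := by
    by_contra hne
    rcases b4 with h | h
    · exact hne h
    obtain ⟨X', hX', hs, hc⟩ := hcount H2 (lt_of_le_of_ne b2 hne)
    have h1 := h X' hX' hs
    obtain ⟨b, hb⟩ := AddSubgroup.card_dvd_of_le b2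
    have h2pos : 0 < Nat.card H2 := Nat.card_pos
    generalize Nat.card H2 = h2 at *
    rw [hb] at h1 hc
    have h3 : X'.card + 1 < b := lt_of_mul_lt_mul_left h1 (Nat.zero_le _)
    obtain ⟨e, rfl⟩ : ∃ e, b = e + 2 := ⟨b - 2, by omega⟩
    obtain ⟨d', rfl⟩ : ∃ d', d = d' + 1 := ⟨d - 1, by omega⟩
    obtain ⟨k, rfl⟩ : ∃ k, h2 = k + 1 := ⟨h2 - 1, by omega⟩
    nlinarith [Nat.zero_le (d' * k), Nat.zero_le (d' * k * e), Nat.zero_le (k * e), Nat.zero_le (d' * e)]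
  subst hH2
  have hdis : V ∩ (I1 ∪ I2) ⊆ I2 := by
    intro j hj
    simp only [Finset.mem_inter, Finset.mem_union] at hj
    rcases hj.2 with h | h
    · have := a3.1 h
      simp [hj.1] at this
    · exact h
  have hcV := Finset.card_le_card hdis
  refine ⟨I1 ∪ I2, wd_rf_comp a1 a2 ⟨a3.1.trans Finset.sdiff_subset, a3.2⟩ b3, ?_⟩
  by_cases hEq : H1 = H2
  · left
    subst hEq
    have h1 := b3.2.2.1
    have h2pos : 0 < Nat.card H1 := Nat.card_pos
    have : I2.card = 0 := by nlinarith
    omega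
  · rcases a4 with h | h
    · exact absurd h hEq
    obtain ⟨X', hX', hs, hc⟩ := hcount H1 (lt_of_le_of_ne a2 hEq)
    have h1 := h (X' \ V) (Finset.sdiff_subset_sdiff hX' subset_rfl)
      (fun j hj => hs j (Finset.sdiff_subset hj))
    obtain ⟨b, hb⟩ := AddSubgroup.card_dvd_of_le a2
    have hI2 := b3.2.2.1
    have h2pos : 0 < Nat.card H1 := Nat.card_pos
    generalize Nat.card H1 = h2 at *
    rw [hb] at h1 hc hI2
    have h3 : (X' \ V).card + 1 < b := lt_of_mul_lt_mul_left h1 (Nat.zero_le _)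
    have h4 : I2.card + 1 ≤ b := by
      rw [mul_comm] at hI2
      exact le_of_mul_le_mul_left hI2 h2pos
    have h5 : X'.card ≤ (X' \ V).card + V.card := by
      have := Finset.le_card_sdiff V X'
      omega
    have h6 : V.card = (V \ (I1 ∪ I2)).card + (V ∩ (I1 ∪ I2)).card :=
      (Finset.card_sdiff_add_card_inter _ _).symm
    by_cases hb2 : b ≤ 2
    · left; omega
    right
    by_cases hd : d = 1
    · omega
    obtain ⟨e, rfl⟩ : ∃ e, b = e + 3 := ⟨b - 3, by omega⟩
    obtain ⟨d', rfl⟩ : ∃ d', d = d' + 2 := ⟨d - 2, by omega⟩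
    obtain ⟨k, rfl⟩ : ∃ k, h2 = k + 1 := ⟨h2 - 1, by omega⟩
    nlinarith [Nat.zero_le (d' * k), Nat.zero_le (d' * k * e), Nat.zero_le (k * e), Nat.zero_le (d' * e)]

theorem wd_gcd (A : Finset ℤ) : ∃ g : ℤ, ∀ (G : Type) [AddCommGroup G] (H : AddSubgroup G) (x : G),
    (∀ a ∈ A, ∀ b ∈ A, a • x - b • x ∈ H) ↔ g • x ∈ H := by
  obtain ⟨g, hg⟩ := Int.subgroup_cyclic (AddSubgroup.closure {k : ℤ | ∃ a ∈ A, ∃ b ∈ A, k = a - b})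
  refine ⟨g, fun G _ H x => ?_⟩
  let K : AddSubgroup ℤ := H.comap (zmultiplesHom G x)
  have hK : ∀ k, k ∈ K ↔ k • x ∈ H := fun k => by simp [K]
  rw [← hK]
  have : AddSubgroup.closure {k : ℤ | ∃ a ∈ A, ∃ b ∈ A, k = a - b} ≤ K ↔ g ∈ K := by
    rw [hg, AddSubgroup.closure_le, Set.singleton_subset_iff]; rfl
  rw [← this, AddSubgroup.closure_le]
  constructor
  · rintro h k ⟨a, ha, b, hb, rfl⟩
    exact (hK _).2 (by rw [sub_smul]; exact h a ha b hb)
  · intro h a ha b hb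
    have := (hK _).1 (h ⟨a, ha, b, hb, rfl⟩)
    rwa [sub_smul] at this

theorem wd_map_card {G Q : Type*} [AddCommGroup G] [AddCommGroup Q] [Finite G] (f : G →+ Q)
    (K : AddSubgroup G) : Nat.card (f.ker ⊓ K : AddSubgroup G) * Nat.card (K.map f) = Nat.card K := by
  rw [← AddSubgroup.relIndex_ker, ← AddSubgroup.inf_relIndex_right]
  rw [← AddSubgroup.relIndex_bot_left, ← AddSubgroup.relIndex_bot_left K]
  exact AddSubgroup.relIndex_mul_relIndex _ _ _ bot_le inf_le_right
end

section

/-- Weighted Gao theorem. -/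
theorem wd_gao {G : Type} [AddCommGroup G] [Fintype G] (A : Finset ℤ) (hA : A.Nonempty)
    (D : ℕ)
    (hD : ∀ y : Fin D → G, ∃ (s : Finset (Fin D)) (w : Fin D → ℤ),
      s.Nonempty ∧ (∀ i ∈ s, w i ∈ A) ∧ ∑ i ∈ s, w i • y i = 0)
    {ι : Type} [Fintype ι] [DecidableEq ι] (n : ℕ) (hn : n = Nat.card G)
    (ht : Fintype.card ι = n + D - 1) (x : ι → G) :
    ∃ (s : Finset ι) (w : ι → ℤ), s.card = n ∧ (∀ i ∈ s, w i ∈ A) ∧ ∑ i ∈ s, w i • x i = 0 := by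
  classical
  have hD1 : 1 ≤ D := by
    by_contra h
    have h0 : D = 0 := by omega
    subst h0
    obtain ⟨s, w, ⟨i, _⟩, _⟩ := hD (fun _ => 0)
    exact i.elim0
  obtain ⟨a0, ha0⟩ := hA
  obtain ⟨g, hg⟩ := wd_gcd A
  let φ : G →+ G := zsmulAddGroupHom g
  have hφ : ∀ y, φ y = g • y := fun y => rfl
  let B : ι → Finset G := fun j => A.image (fun a => a • x j)
  have hB : ∀ j, (B j).Nonempty := fun j => ⟨_, Finset.mem_image_of_mem _ ha0⟩
  have hsing : ∀ H j, WdSing B H j ↔ x j ∈ H.comap φ := by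
    intro H j
    rw [AddSubgroup.mem_comap, hφ, ← hg G H (x j)]
    constructor
    · intro h a ha b hb
      exact h _ (Finset.mem_image_of_mem _ ha) _ (Finset.mem_image_of_mem _ hb)
    · intro h p hp r hr
      obtain ⟨a, ha, rfl⟩ := Finset.mem_image.1 hp
      obtain ⟨b, hb, rfl⟩ := Finset.mem_image.1 hr
      exact h a ha b hb
  let U : AddSubgroup G → Finset ι := fun H => Finset.univ.filter (fun j => x j ∉ H.comap φ)
  have hcomap : ∀ H : AddSubgroup G, H ≤ φ.range → Nat.card (H.comap φ) = Nat.card φ.ker * Nat.card H := by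
    intro H hH
    have h1 := wd_map_card φ (H.comap φ)
    rw [AddSubgroup.map_comap_eq_self hH] at h1
    rw [← h1]
    congr 2
    rw [inf_eq_left.2]
    intro y hy
    rw [AddSubgroup.mem_comap, (AddMonoidHom.mem_ker).1 hy]
    exact H.zero_mem
  cases nonempty_fintype (AddSubgroup G)
  obtain ⟨H, hHm, hmin⟩ := (Finset.univ.filter (fun H : AddSubgroup G =>
    (U H).card + Nat.card (H.comap φ) ≤ n)).exists_min_image (fun K => Nat.card K) ⟨⊤, by
      simp [U, hn]⟩
  simp only [Finset.mem_filter, Finset.mem_univ, true_and] at hHm hmin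
  have hHr : H ≤ φ.range := by
    have he : (H ⊓ φ.range).comap φ = H.comap φ := by
      ext y; simp
    have h1 := hmin (H ⊓ φ.range) (by simp only [U, he]; exact hHm)
    have h2 := AddSubgroup.eq_of_le_of_card_ge (inf_le_left : H ⊓ φ.range ≤ H) h1
    exact inf_eq_left.1 h2
  set d := Nat.card φ.ker with hd
  have hHc := hcomap H hHr
  rw [hHc] at hHm
  have hmin' : ∀ H' < H, n < (U H').card + d * Nat.card H' := by
    intro H' hlt
    rw [hd, ← hcomap H' (hlt.le.trans hHr)]
    by_contra hcon
    have := hmin H' (not_lt.1 hcon)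
    exact hlt.ne (AddSubgroup.eq_of_le_of_card_ge hlt.le this)
  set h := Nat.card H with hh
  have hhpos : 0 < h := Nat.card_pos
  have hdpos : 0 < d := Nat.card_pos
  let N : Finset ι := Finset.univ.filter (fun j => x j ∈ H.comap φ)
  let O : Finset ι := U H
  have hNO : N.card + O.card = n + D - 1 := by
    rw [← ht, ← Finset.card_univ]
    exact Finset.card_filter_add_card_filter_not _
  have hNdO : ∀ j, j ∈ N ↔ j ∉ O := by
    intro j; simp [N, O, U]
  have hNmem : ∀ j, j ∈ N ↔ x j ∈ H.comap φ := by intro j; simp [N]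
  have hNne : N.Nonempty := by
    rw [← Finset.card_pos]
    have : 0 < d * h := Nat.mul_pos hdpos hhpos
    have h2 : O.card + d * h ≤ n := hHm
    omega
  -- weights on elements of the preimage agree modulo `H`
  have hwt : ∀ y ∈ H.comap φ, ∀ a ∈ A, a • y - a0 • y ∈ H := by
    intro y hy a ha
    rw [AddSubgroup.mem_comap, hφ] at hy
    exact (hg G H y).2 hy a ha a0 ha0
  let ψ : G →+ G ⧸ H := (QuotientAddGroup.mk' H).comp (zsmulAddGroupHom a0)
  have hψ : ∀ y, ψ y = QuotientAddGroup.mk' H (a0 • y) := fun y => rfl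
  have hψ0 : ∀ y, ψ y = 0 ↔ a0 • y ∈ H := fun y => by
    rw [hψ, ← AddMonoidHom.mem_ker, QuotientAddGroup.ker_mk']
  let L := (H.comap φ).map ψ
  set q := Nat.card L with hq
  have hqpos : 0 < q := Nat.card_pos
  have hhq : h * q ≤ d * h := by
    rw [hd, hh, ← hHc, ← wd_map_card ψ (H.comap φ)]
    apply Nat.mul_le_mul_right
    apply AddSubgroup.card_le_of_le
    intro y hy
    refine AddSubgroup.mem_inf.2 ⟨?_, ?_⟩
    · rw [AddMonoidHom.mem_ker, hψ0]; exact H.zsmul_mem hy _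
    · rw [AddSubgroup.mem_comap, hφ]; exact H.zsmul_mem hy _
  have hqd : q ≤ d := by
    rw [mul_comm] at hhq
    exact le_of_mul_le_mul_right hhq hhpos
  obtain ⟨j0, hj0, hj0max⟩ := N.exists_max_image
    (fun j => (N.filter (fun i => ψ (x i) = ψ (x j))).card) hNne
  let V := N.filter (fun i => ψ (x i) = ψ (x j0))
  let z := x j0
  let y : ι → G := fun j => x j - z
  have hz : z ∈ H.comap φ := (hNmem _).1 hj0
  have hVN : V ⊆ N := Finset.filter_subset _ _
  have hyM : ∀ j ∈ N, y j ∈ H.comap φ := fun j hj => (H.comap φ).sub_mem ((hNmem _).1 hj) hz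
  have hyV : ∀ j ∈ V, ψ (y j) = 0 := by
    intro j hj
    simp only [y, map_sub]
    rw [(Finset.mem_filter.1 hj).2]
    exact sub_self _
  obtain ⟨Y, 𝓑, hY1, hY2, hBd, hBu, hBb⟩ := wd_extract L (fun j => ψ (y j)) V.card _ (N \ V) rfl
    (fun j hj => AddSubgroup.mem_map_of_mem ψ (hyM j (Finset.sdiff_subset hj))) (by
      intro a
      by_cases hem : ((N \ V).filter (fun j => ψ (y j) = a)).Nonempty
      · obtain ⟨i, hi⟩ := hem
        rw [Finset.mem_filter] at hi
        have hiN : i ∈ N := Finset.sdiff_subset hi.1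
        refine le_trans (Finset.card_le_card ?_) (hj0max i hiN)
        intro j hj
        rw [Finset.mem_filter] at hj ⊢
        refine ⟨Finset.sdiff_subset hj.1, ?_⟩
        have := hj.2.trans hi.2.symm
        simp only [y, map_sub] at this
        exact sub_left_injective this
      · rw [Finset.not_nonempty_iff_eq_empty.1 hem]; simp)
  rw [← hq] at hY2 hBb
  obtain ⟨F, hF, w, hw, hFs, hFc⟩ := wd_maxzero A D a0 ha0 hD y (O ∪ Y)
  have hYN : Y ⊆ N := hY1.trans Finset.sdiff_subset
  have hOY : Disjoint O Y := by
    rw [Finset.disjoint_left]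
    intro j hj hj'
    exact (hNdO j).1 (hYN hj') hj
  obtain ⟨I, hI, hIV⟩ := wd_fill B hB H N V Y d q hqpos hqd
    (fun j hj => (hsing H j).2 ((hNmem j).1 hj)) (by
      intro H' hlt
      refine ⟨(U H' \ O) \ Y, ?_, ?_, ?_⟩
      · intro j hj
        simp only [Finset.mem_sdiff] at hj ⊢
        exact ⟨(hNdO j).2 hj.1.2, hj.2⟩
      · intro j hj
        have := (Finset.mem_filter.1 (Finset.sdiff_subset (Finset.sdiff_subset hj))).2
        rwa [hsing]
      · have h1 := hmin' H' hlt
        have h2 := Finset.le_card_sdiff Y (U H' \ O)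
        have h3 := Finset.le_card_sdiff O (U H')
        have h4 : O.card + d * h ≤ n := hHm
        rw [← hh]
        omega)
  obtain ⟨hIX, hIs, hIc, hIfull⟩ := hI
  have hIc' : I.card + 1 ≤ h := by
    rw [AddSubgroup.card_bot, mul_one] at hIc; exact hIc
  let M := 𝓑.filter (fun b => ¬ Disjoint b I)
  have hOn : O.card + d * h ≤ n := hHm
  have hFcard : F.card + ((O ∪ Y) \ F).card = O.card + Y.card := by
    rw [← Finset.card_union_of_disjoint hOY, add_comm]
    exact Finset.card_sdiff_add_card_eq_card hF
  have hVI : (V \ I).card + (V ∩ I).card = V.card := Finset.card_sdiff_add_card_inter _ _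
  have hMcard : M.card ≤ (I \ V).card := by
    have hch : ∀ b ∈ M, ∃ j, j ∈ b ∧ j ∈ I := by
      intro b hb
      exact Finset.not_disjoint_iff.1 (Finset.mem_filter.1 hb).2
    have hι : Nonempty ι := ⟨j0⟩
    choose! e he1 he2 using hch
    apply Finset.card_le_card_of_injOn e
    · intro b hb
      have hb' : b ∈ M := hb
      have hbB : b ∈ 𝓑 := (Finset.mem_filter.1 hb').1
      have h1 : e b ∈ 𝓑.biUnion id := Finset.mem_biUnion.2 ⟨b, hbB, he1 b hb'⟩
      rw [hBu] at h1
      simp only [Finset.mem_sdiff] at h1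
      have := he2 b hb'
      simp [this, h1.1.2]
    · intro b hb b' hb' hee
      by_contra hne
      have hdd := hBd b (Finset.mem_filter.1 hb).1 b' (Finset.mem_filter.1 hb').1 hne
      exact Finset.disjoint_left.1 hdd (he1 b hb) (hee ▸ he1 b' hb')
  have hIVc : (I \ V).card + (V ∩ I).card = I.card := by
    rw [Finset.inter_comm]; exact Finset.card_sdiff_add_card_inter _ _
  have hMsum : ∑ b ∈ M, b.card ≤ M.card * q := by
    rw [← smul_eq_mul]
    exact Finset.sum_le_card_nsmul _ _ _ (fun b hb => (hBb b (Finset.mem_filter.1 hb).1).2.1)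
  have hBsum : ∑ b ∈ 𝓑, b.card = ((N \ V) \ Y).card := by
    rw [← hBu, Finset.card_biUnion]
    · rfl
    · exact hBd
  have hNc : ((N \ V) \ Y).card + Y.card + V.card = N.card := by
    have h1 := Finset.card_sdiff_add_card_eq_card hY1
    have h2 := Finset.card_sdiff_add_card_eq_card hVN
    omega
  obtain ⟨C, hMC, hCB, hC1, hC2⟩ := wd_select Finset.card M 𝓑 (Finset.filter_subset _ _)
    (F.card + (V ∩ I).card) n (V \ I).card (by
      have h1 : (I.card + 1) * q ≤ d * h := (Nat.mul_le_mul_right q hIc').trans hhq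
      have h2 : M.card * q ≤ (I \ V).card * q := Nat.mul_le_mul_right q hMcard
      have h3 : (V ∩ I).card ≤ (V ∩ I).card * q := Nat.le_mul_of_pos_right _ hqpos
      have h4 : (I.card + 1) * q = (I \ V).card * q + (V ∩ I).card * q + q := by
        rw [← hIVc]; ring
      omega) (by
      rw [hBsum]
      omega) (by
      intro b hb
      have h1 := hBb b hb
      rcases hIV with h2 | h2
      · have := h1.1
        omega
      · have := h1.2.1
        omega)
  obtain ⟨V', hV', hV'c⟩ := Finset.exists_subset_card_eq
    (show n - (F.card + (V ∩ I).card + ∑ b ∈ C, b.card) ≤ (V \ I).card by omega)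
  have hCu : C.biUnion id ⊆ (N \ V) \ Y := by
    rw [← hBu]; exact Finset.biUnion_subset_biUnion_of_subset_left _ hCB
  have hCc : (C.biUnion id).card = ∑ b ∈ C, b.card := by
    rw [Finset.card_biUnion]
    · rfl
    · intro b hb b' hb' hne
      exact hBd b (hCB hb) b' (hCB hb') hne
  let J2 := (V ∩ I) ∪ V'
  have hJ2V : J2 ⊆ V := Finset.union_subset Finset.inter_subset_left (hV'.trans Finset.sdiff_subset)
  have hdis1 : Disjoint (V ∩ I) V' := by
    rw [Finset.disjoint_left]
    intro j hj hj'
    have := hV' hj'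
    simp only [Finset.mem_sdiff, Finset.mem_inter] at this hj
    exact this.2 hj.2
  have hdis2 : Disjoint (C.biUnion id) J2 := by
    rw [Finset.disjoint_left]
    intro j hj hj'
    have h1 := hCu hj
    simp only [Finset.mem_sdiff] at h1
    exact h1.1.2 (hJ2V hj')
  have hFnot : ∀ j ∈ F, j ∈ N → j ∈ Y := by
    intro j hj hjN
    rcases Finset.mem_union.1 (hF hj) with h1 | h1
    · exact absurd h1 ((hNdO j).1 hjN)
    · exact h1
  have hYV : ∀ j ∈ Y, j ∉ V := fun j hj => (Finset.mem_sdiff.1 (hY1 hj)).2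
  have hdis3 : Disjoint F (C.biUnion id ∪ J2) := by
    rw [Finset.disjoint_left]
    intro j hj hj'
    rcases Finset.mem_union.1 hj' with h1 | h1
    · have h2 := hCu h1
      simp only [Finset.mem_sdiff] at h2
      exact h2.2 (hFnot j hj h2.1.1)
    · exact hYV j (hFnot j hj (hVN (hJ2V h1))) (hJ2V h1)
  let J := F ∪ (C.biUnion id ∪ J2)
  have hJc : J.card = n := by
    simp only [J, J2]
    rw [Finset.card_union_of_disjoint hdis3, Finset.card_union_of_disjoint hdis2,
      Finset.card_union_of_disjoint hdis1, hCc, hV'c]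
    omega
  have hIJ : I ⊆ J := by
    intro j hj
    have h1 := Finset.mem_sdiff.1 (hIX hj)
    by_cases hjV : j ∈ V
    · simp only [J, J2, Finset.mem_union, Finset.mem_inter]
      exact Or.inr (Or.inr (Or.inl ⟨hjV, hj⟩))
    · have h2 : j ∈ 𝓑.biUnion id := by
        rw [hBu]; simp [h1.1, h1.2, hjV]
      obtain ⟨b, hb, hjb⟩ := Finset.mem_biUnion.1 h2
      have hbM : b ∈ M := Finset.mem_filter.2 ⟨hb, Finset.not_disjoint_iff.2 ⟨j, hjb, hj⟩⟩
      exact Finset.mem_union_right _ (Finset.mem_union_left _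
        (Finset.mem_biUnion.2 ⟨b, hMC hbM, hjb⟩))
  have hIF : ∀ j ∈ I, j ∉ F := by
    intro j hj hjF
    have h1 := Finset.mem_sdiff.1 (hIX hj)
    exact h1.2 (hFnot j hjF h1.1)
  let w1 : ι → ℤ := fun j => if j ∈ F then w j else a0
  have hw1A : ∀ j, w1 j ∈ A := by
    intro j
    by_cases hj : j ∈ F
    · simpa [w1, hj] using hw j
    · simpa [w1, hj] using ha0
  have hsumy : ∑ j ∈ J, w1 j • y j ∈ H := by
    simp only [J]
    rw [Finset.sum_union hdis3, Finset.sum_union hdis2]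
    have e1 : ∑ j ∈ F, w1 j • y j = 0 := by
      rw [← hFs]
      exact Finset.sum_congr rfl (fun j hj => by simp [w1, hj])
    have hw1' : ∀ j ∈ C.biUnion id ∪ J2, w1 j = a0 := by
      intro j hj
      simp [w1, Finset.disjoint_right.1 hdis3 hj]
    have e2 : ∑ j ∈ C.biUnion id, w1 j • y j = ∑ b ∈ C, ∑ j ∈ b, a0 • y j := by
      rw [Finset.sum_congr rfl (fun j hj => by rw [hw1' j (Finset.mem_union_left _ hj)])]
      rw [Finset.sum_biUnion]
      · rfl
      · intro b hb b' hb' hne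
        exact hBd b (hCB hb) b' (hCB hb') hne
    rw [e1, e2, zero_add]
    apply H.add_mem
    · apply H.sum_mem
      intro b hb
      have := (hBb b (hCB hb)).2.2
      rw [← map_sum, hψ0, Finset.smul_sum] at this
      exact this
    · apply H.sum_mem
      intro j hj
      rw [hw1' j (Finset.mem_union_right _ hj), ← hψ0]
      exact hyV j (hJ2V hj)
  have hsumx : ∑ j ∈ J, w1 j • x j ∈ H := by
    have e1 : ∑ j ∈ J, w1 j • x j = ∑ j ∈ J, w1 j • y j + ∑ j ∈ J, (w1 j • z - a0 • z) := by
      rw [Finset.sum_sub_distrib, Finset.sum_const, hJc, hn, card_nsmul_eq_zero', sub_zero,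
        ← Finset.sum_add_distrib]
      apply Finset.sum_congr rfl
      intro j _
      simp only [y]
      rw [smul_sub]; abel
    rw [e1]
    exact H.add_mem hsumy (H.sum_mem (fun j _ => hwt z hz _ (hw1A j)))
  obtain ⟨c', hc', hce⟩ := hIfull (fun j => a0 • x j)
    (fun j _ => Finset.mem_image_of_mem _ ha0) _ (H.neg_mem hsumx)
  have hch : ∀ j ∈ I, ∃ a ∈ A, a • x j = c' j := fun j hj => by
    simpa [B] using hc' j hj
  choose! w2 hw2 hw2' using hch
  rw [AddSubgroup.mem_bot] at hce
  refine ⟨J, fun j => if j ∈ I then w2 j else w1 j, hJc, ?_, ?_⟩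
  · intro j _
    by_cases hj : j ∈ I
    · simpa [hj] using hw2 j hj
    · simpa [hj] using hw1A j
  · have e3 := Finset.sum_sdiff (f := fun j => w1 j • x j) hIJ
    rw [← Finset.sum_sdiff hIJ]
    have e1 : ∑ j ∈ J \ I, (if j ∈ I then w2 j else w1 j) • x j = ∑ j ∈ J \ I, w1 j • x j :=
      Finset.sum_congr rfl (fun j hj => by simp [(Finset.mem_sdiff.1 hj).2])
    have e2 : ∑ j ∈ I, (if j ∈ I then w2 j else w1 j) • x j = ∑ j ∈ I, c' j :=
      Finset.sum_congr rfl (fun j hj => by simp [hj, hw2' j hj])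
    have e4 : ∑ j ∈ I, w1 j • x j = ∑ j ∈ I, a0 • x j :=
      Finset.sum_congr rfl (fun j hj => by simp [w1, hIF j hj])
    rw [e1, e2, sub_eq_zero.1 hce, ← e3, e4]
    abel
end


/-- Under the assumptions `0 ∉ Σ_n`, trivial stabilizer and multiplicity at most
`n`, the number `r` of indices with `|A_i| = 1` satisfies `r ≥ 2·D_A(G)`. -/
theorem singleton_count_ge (n : ℕ) (hn : 0 < n) (A : Finset ℤ) (hA : A.Nonempty)
    (D : ℕ)
    (hD : IsLeast {k : ℕ | ∀ y : Fin k → ZMod n, ∃ (s : Finset (Fin k)) (w : Fin k → ℤ),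
      s.Nonempty ∧ (∀ i ∈ s, w i ∈ A) ∧ ∑ i ∈ s, w i • y i = 0} D)
    (t : ℕ) (ht : t = n + D - 1) (x : Fin t → ZMod n)
    (T : Set (ZMod n))
    (hT : T = {g | ∃ (s : Finset (Fin t)) (w : Fin t → ℤ),
      s.card = n ∧ (∀ i ∈ s, w i ∈ A) ∧ ∑ i ∈ s, w i • x i = g})
    (h0 : (0 : ZMod n) ∉ T)
    (hstab : ∀ h : ZMod n, (h + ·) '' T = T → h = 0)
    (hmult : ∀ a : ZMod n,
      (Finset.univ.filter (fun j => a ∈ A.image (fun b => b • x j))).card ≤ n) :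
    2 * D ≤ (Finset.univ.filter (fun i : Fin t =>
      (A.image (fun b => b • x i)).card = 1)).card := by
  exfalso
  have : NeZero n := ⟨hn.ne'⟩
  apply h0
  rw [hT]
  exact wd_gao A hA D hD.1 n (by simp) (by simpa using ht) x
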